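/- Consider n units. For each unit i let S_i : Ω → {e, o}, let D_i : Ω → {0, 1} be its treatment, let D_{−i} : Ω → {0, 1}^{n−1} collect the other units' treatments, let η_i : Ω → E_i be unobserved heterogeneity taking values in a measurable space E_i, and let the realized outcome be Y_i := f_i(D_i, D_{−i}, η_i) for a measurable f_i : {0, 1} × {0, 1}^{n−1} × E_i → {0, 1}. Suppose for each i: P(D_i = d, S_i = e) > 0 for d ∈ {0, 1}, and under P(·|S_i = e) the treatment D_i is independent of η_i. For each d let G_{i,d} : E_i → ℝ be measurable with G_{i,d} ∘ η_i a version of the conditional expectation of f_i(d, D_{−i}, η_i) given σ(η_i) under P(·|D_i = d, S_i = e); define the direct potential outcome Y_i^{dir}(d) := G_{i,d}(η_i) and the average direct treatment effect θ_n := (1/n) Σ_{i=1}^n E[Y_i^{dir}(1) − Y_i^{dir}(0) | S_i = e]. Then θ_n = (1/n) Σ_{i=1}^n ( E[Y_i | D_i = 1, S_i = e] − E[Y_i | D_i = 0, S_i = e] ), i.e. the average direct treatment effect equals the average of unit-level differences of conditional outcome means. -/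

import Mathlib

open MeasureTheory ProbabilityTheory

noncomputable section

/-- Sample indicator values: experimental (`e`) or observational (`o`). -/
inductive Sample : Type
  | e
  | o
deriving DecidableEq

instance : MeasurableSpace Sample := ⊤

/-- Real-valued indicator of a boolean (`{0,1}`-valued variable). -/
def b2r (b : Bool) : ℝ := if b then 1 else 0

/-- `CondIndepOf P R V W` : the conditional law of `R` given `V = v, W = w` agrees with
the conditional law of `R` given `V = v`, for all values with positive probability;
this is the notion of "R is conditionally independent of W given V" for variables with
countable ranges. -/
def CondIndepOf {Ω 𝓡 V W : Type*} [MeasurableSpace Ω] [MeasurableSpace 𝓡]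
    (P : Measure Ω) (R : Ω → 𝓡) (Vf : Ω → V) (Wf : Ω → W) : Prop :=
  ∀ v w, 0 < P {ω | Vf ω = v ∧ Wf ω = w} →
    (P[|{ω | Vf ω = v ∧ Wf ω = w}]).map R = (P[|{ω | Vf ω = v}]).map R

/-- Conditioning on an event of an independent variable does not change the law. -/
theorem map_cond_preimage_of_indepFun {Ω α β : Type*} [MeasurableSpace Ω] [MeasurableSpace α]
    [MeasurableSpace β] {μ : Measure Ω} [IsProbabilityMeasure μ] {X : Ω → α} {Z : Ω → β}
    (h : IndepFun X Z μ) (hX : Measurable X) (hZ : Measurable Z) {s : Set α}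
    (hs : MeasurableSet s) (h0 : μ (X ⁻¹' s) ≠ 0) :
    (μ[|X ⁻¹' s]).map Z = μ.map Z := by
  ext t ht
  rw [Measure.map_apply hZ ht, Measure.map_apply hZ ht, cond_apply (hX hs),
    h.measure_inter_preimage_eq_mul s t hs ht, ← mul_assoc,
    ENNReal.inv_mul_cancel h0 (measure_ne_top _ _), one_mul]

/-- Under randomization within the event `A`, a version `g ∘ η` of the conditional expectation
of `W` given `η` in the arm `X = d` is integrable given `A`, with mean the mean of `W` in that
arm. -/
theorem integrable_and_integral_eq_of_randomized {Ω β : Type*} [MeasurableSpace Ω]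
    [MeasurableSpace β] {P : Measure Ω} [IsProbabilityMeasure P] {A : Set Ω}
    (hA : MeasurableSet A) {X : Ω → Bool} (hX : Measurable X) {η : Ω → β} (hη : Measurable η)
    (d : Bool) (hpos : 0 < P {ω | X ω = d ∧ ω ∈ A}) (h : IndepFun X η (P[|A]))
    {g : β → ℝ} (hg : Measurable g) {W : Ω → ℝ}
    (hgW : (fun ω => g (η ω)) =ᵐ[P[|{ω | X ω = d ∧ ω ∈ A}]]
      (P[|{ω | X ω = d ∧ ω ∈ A}])[W | MeasurableSpace.comap η inferInstance]) :
    Integrable (fun ω => g (η ω)) (P[|A]) ∧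
      ∫ ω, g (η ω) ∂(P[|A]) = ∫ ω, W ω ∂(P[|{ω | X ω = d ∧ ω ∈ A}]) := by
  have hXd : MeasurableSet (X ⁻¹' {d}) := hX (measurableSet_singleton d)
  have hset : {ω | X ω = d ∧ ω ∈ A} = A ∩ X ⁻¹' {d} := by
    ext ω
    simp [and_comm]
  rw [hset] at hpos hgW ⊢
  have hA0 : P A ≠ 0 := (hpos.trans_le (measure_mono Set.inter_subset_left)).ne'
  have := cond_isProbabilityMeasure hA0
  have := cond_isProbabilityMeasure hpos.ne'
  have hd0 : (P[|A]) (X ⁻¹' {d}) ≠ 0 := (cond_pos_of_inter_ne_zero hA hpos.ne').ne'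
  have hmap : (P[|A ∩ X ⁻¹' {d}]).map η = (P[|A]).map η := by
    rw [← cond_cond_eq_cond_inter hA hXd]
    exact map_cond_preimage_of_indepFun h hX hη (measurableSet_singleton d) hd0
  have hint : Integrable (fun ω => g (η ω)) (P[|A ∩ X ⁻¹' {d}]) :=
    integrable_condExp.congr hgW.symm
  constructor
  · refine (integrable_map_measure hg.aestronglyMeasurable hη.aemeasurable).1 ?_
    rw [← hmap]
    exact (integrable_map_measure hg.aestronglyMeasurable hη.aemeasurable).2 hint
  · rw [← integral_map hη.aemeasurable hg.aestronglyMeasurable, ← hmap,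
      integral_map hη.aemeasurable hg.aestronglyMeasurable, integral_congr_ae hgW,
      integral_condExp hη.comap_le]

/-- **Lemma (Average direct treatment effect equals difference of means), spillover
setting.** With outcomes `Y_i = f_i(D_i, D_{−i}, η_i)` and unit-level randomization,
the average direct treatment effect equals the average of unit-level differences of
conditional outcome means. -/
theorem statement15
    {Ω : Type*} [MeasurableSpace Ω]
    (P : Measure Ω) [IsProbabilityMeasure P]
    (n : ℕ) (hn : 0 < n)
    {E : Fin n → Type*} [∀ i, MeasurableSpace (E i)]
    (S : Fin n → Ω → Sample) (D : Fin n → Ω → Bool)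
    (Dm : Fin n → Ω → (Fin (n - 1) → Bool))
    (η : (i : Fin n) → Ω → E i)
    (f : (i : Fin n) → Bool → (Fin (n - 1) → Bool) → E i → Bool)
    (hS : ∀ i, Measurable (S i)) (hD : ∀ i, Measurable (D i))
    (hDm : ∀ i, Measurable (Dm i)) (hη : ∀ i, Measurable (η i))
    (hf : ∀ i, Measurable fun q : Bool × (Fin (n - 1) → Bool) × E i =>
      f i q.1 q.2.1 q.2.2)
    (Y : Fin n → Ω → Bool)
    (hYdef : ∀ i ω, Y i ω = f i (D i ω) (Dm i ω) (η i ω))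
    -- Positivity: P(D_i = d, S_i = e) > 0
    (positivity : ∀ (i : Fin n) (d : Bool),
      0 < P {ω | D i ω = d ∧ S i ω = Sample.e})
    -- Randomization: D_i ⫫ η_i under P(·|S_i = e)
    (randomization : ∀ i, IndepFun (D i) (η i) (P[|{ω | S i ω = Sample.e}]))
    -- G_{i,d} ∘ η_i is a version of E[f_i(d, D_{−i}, η_i) | σ(η_i)] under
    -- P(·|D_i = d, S_i = e); Y_i^{dir}(d) := G_{i,d}(η_i)
    (G : (i : Fin n) → Bool → E i → ℝ)
    (hGmeas : ∀ i d, Measurable (G i d))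
    (hGce : ∀ (i : Fin n) (d : Bool),
      (fun ω => G i d (η i ω))
        =ᵐ[P[|{ω | D i ω = d ∧ S i ω = Sample.e}]]
          (P[|{ω | D i ω = d ∧ S i ω = Sample.e}])[(fun ω =>
              b2r (f i d (Dm i ω) (η i ω))) |
            MeasurableSpace.comap (η i) inferInstance])
    -- θ_n := (1/n) Σ_i E[Y_i^{dir}(1) − Y_i^{dir}(0) | S_i = e]
    (θn : ℝ)
    (hθn : θn = (1 / (n : ℝ)) * ∑ i : Fin n,
      ∫ ω, (G i true (η i ω) - G i false (η i ω))
        ∂(P[|{ω | S i ω = Sample.e}])) :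
    θn = (1 / (n : ℝ)) * ∑ i : Fin n,
      ((∫ ω, b2r (Y i ω) ∂(P[|{ω | D i ω = true ∧ S i ω = Sample.e}])) -
        (∫ ω, b2r (Y i ω) ∂(P[|{ω | D i ω = false ∧ S i ω = Sample.e}]))) := by
  rw [hθn]
  congr 1
  refine Finset.sum_congr rfl fun i _ => ?_
  have hA : MeasurableSet {ω | S i ω = Sample.e} :=
    hS i (MeasurableSpace.measurableSet_top (s := {Sample.e}))
  have key (d : Bool) := integrable_and_integral_eq_of_randomized hA (hD i) (hη i) d
    (positivity i d) (randomization i) (hGmeas i d) (hGce i d)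
  have hY (d : Bool) : ∫ ω, b2r (f i d (Dm i ω) (η i ω))
        ∂(P[|{ω | D i ω = d ∧ S i ω = Sample.e}]) =
      ∫ ω, b2r (Y i ω) ∂(P[|{ω | D i ω = d ∧ S i ω = Sample.e}]) := by
    refine integral_congr_ae ?_
    filter_upwards [ae_cond_mem ((hD i (measurableSet_singleton d)).inter hA)] with ω hω
    rw [hYdef, hω.1]
  rw [integral_sub (key true).1 (key false).1, ← hY true, ← hY false]
  exact congrArg₂ _ (key true).2 (key false).2
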